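/- arXiv:2604.07794 — 2 statements merged into one kernel-verified Lean document; each statement's English description precedes it below -/
import Mathlib

section
/- Let H = (V, E) be a hypergraph with an egalitarian δ-orientation, let k be a non-negative integer, and suppose the layer L = D_{k,δ} \ D_{k+1,δ} is nonempty. Then the layer density ρ_d(L) = (Σ_{x∈L} d⃗_x)/|L| satisfies k − 1 < ρ_d(L) ≤ k; in particular, ⌈ρ_d(L)⌉ = k when k ≥ 1. -/
open Finset

section Defs

variable {V : Type*}

/-- A `δ`-orientation of a hypergraph with hyperedge set `E`: each hyperedge `e ∈ E`
gets a head set `Hd e ⊆ e` with `|Hd e| = min δ |e|`. -/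
def IsOrientation [DecidableEq V] (E : Finset (Finset V)) (δ : ℕ)
    (Hd : Finset V → Finset V) : Prop :=
  ∀ e ∈ E, Hd e ⊆ e ∧ (Hd e).card = min δ e.card

/-- The indegree of a vertex `u`: the number of hyperedges whose head set contains `u`. -/
def indeg [DecidableEq V] (E : Finset (Finset V)) (Hd : Finset V → Finset V)
    (u : V) : ℕ :=
  (E.filter fun e => u ∈ Hd e).card

/-- `Reaches E Hd s t`: there is a hyperpath `s = u 0, e 0, u 1, …, e (l-1), u l = t`
(`l ≥ 1`) with `u i` a tail vertex of `e i` and `u (i+1)` a head vertex of `e i`. -/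
def Reaches (E : Finset (Finset V)) (Hd : Finset V → Finset V) (s t : V) : Prop :=
  ∃ (l : ℕ) (u : ℕ → V) (e : ℕ → Finset V), 1 ≤ l ∧ u 0 = s ∧ u l = t ∧
    ∀ i < l, e i ∈ E ∧ u i ∈ e i ∧ u i ∉ Hd (e i) ∧ u (i + 1) ∈ Hd (e i)

/-- An egalitarian `δ`-orientation: a `δ`-orientation admitting no reversible hyperpath,
i.e. no hyperpath `s ⇝ t` with `indeg t - indeg s ≥ 2`. -/
def Egalitarian [DecidableEq V] (E : Finset (Finset V)) (δ : ℕ)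
    (Hd : Finset V → Finset V) : Prop :=
  IsOrientation E δ Hd ∧
    ∀ s t : V, Reaches E Hd s t → indeg E Hd t < indeg E Hd s + 2

/-- `Sk E Hd k`: the set of vertices of indegree at least `k`. -/
def Sk [Fintype V] [DecidableEq V] (E : Finset (Finset V))
    (Hd : Finset V → Finset V) (k : ℕ) : Finset V :=
  Finset.univ.filter fun u => k ≤ indeg E Hd u

open Classical in
/-- The `(k,δ)`-dense subhypergraph (as a vertex set): `S_k` together with all vertices
that can reach some vertex of `S_k` via a hyperpath. -/
noncomputable def denseSet [Fintype V] [DecidableEq V] (E : Finset (Finset V))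
    (Hd : Finset V → Finset V) (k : ℕ) : Finset V :=
  Finset.univ.filter fun u =>
    k ≤ indeg E Hd u ∨ ∃ s, k ≤ indeg E Hd s ∧ Reaches E Hd u s

/-- `E(X)`: the hyperedges entirely contained in `X`. -/
def edgesIn [DecidableEq V] (E : Finset (Finset V)) (X : Finset V) : Finset (Finset V) :=
  E.filter fun e => e ⊆ X

/-- Indegree-based density `ρ_d(X) = (Σ_{x∈X} d⃗_x)/|X|`. -/
noncomputable def rhod [DecidableEq V] (E : Finset (Finset V))
    (Hd : Finset V → Finset V) (X : Finset V) : ℝ :=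
  (∑ x ∈ X, (indeg E Hd x : ℝ)) / (X.card : ℝ)

/-- Degree-density `ρ(X) = (Σ_{x∈X} d_x(X))/|X|`, where `d_x(X)` counts the hyperedges
of `E(X)` containing `x`. -/
noncomputable def rho [DecidableEq V] (E : Finset (Finset V)) (X : Finset V) : ℝ :=
  (∑ x ∈ X, (((edgesIn E X).filter fun e => x ∈ e).card : ℝ)) / (X.card : ℝ)

/-- Internalization coefficient `θ(X) = (Σ_{e∈E(X)} |Hd e|)/(Σ_{x∈X} d⃗_x)`
(equal to `0` when the denominator vanishes, by convention of real division). -/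
noncomputable def theta [DecidableEq V] (E : Finset (Finset V))
    (Hd : Finset V → Finset V) (X : Finset V) : ℝ :=
  (∑ e ∈ edgesIn E X, ((Hd e).card : ℝ)) / (∑ x ∈ X, (indeg E Hd x : ℝ))

/-- `f_k = |S_k| / |D_{k,δ}|`. -/
noncomputable def fk [Fintype V] [DecidableEq V] (E : Finset (Finset V))
    (Hd : Finset V → Finset V) (k : ℕ) : ℝ :=
  ((Sk E Hd k).card : ℝ) / ((denseSet E Hd k).card : ℝ)

/-- The degree `d_x` of a vertex: the number of hyperedges containing it. -/
def degv [DecidableEq V] (E : Finset (Finset V)) (x : V) : ℕ :=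
  (E.filter fun e => x ∈ e).card

/-- `vol(X) = Σ_{x∈X} d_x`. -/
def vol [DecidableEq V] (E : Finset (Finset V)) (X : Finset V) : ℕ :=
  ∑ x ∈ X, degv E x

/-- `∂(X)`: the number of hyperedges meeting both `X` and its complement. -/
def boundaryCount [DecidableEq V] (E : Finset (Finset V)) (X : Finset V) : ℕ :=
  (E.filter fun e => (e ∩ X).Nonempty ∧ (e \ X).Nonempty).card

/-- Conductance `φ(X) = ∂(X)/vol(X)`. -/
noncomputable def phi [DecidableEq V] (E : Finset (Finset V)) (X : Finset V) : ℝ :=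
  (boundaryCount E X : ℝ) / (vol E X : ℝ)

/-- Average degree `d̄(X) = vol(X)/|X|`. -/
noncomputable def dbar [DecidableEq V] (E : Finset (Finset V)) (X : Finset V) : ℝ :=
  (vol E X : ℝ) / (X.card : ℝ)

/-- Average size `r̄(X)` of the hyperedges internal to `X`. -/
noncomputable def rbar [DecidableEq V] (E : Finset (Finset V)) (X : Finset V) : ℝ :=
  (∑ e ∈ edgesIn E X, (e.card : ℝ)) / ((edgesIn E X).card : ℝ)

end Defs

/-- Hyperpaths can be concatenated. -/
theorem Reaches.append {V : Type*} {E : Finset (Finset V)} {Hd : Finset V → Finset V}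
    {s t w : V} (hst : Reaches E Hd s t) (htw : Reaches E Hd t w) : Reaches E Hd s w := by
  obtain ⟨l, u, e, hl, hu0, hul, h⟩ := hst
  obtain ⟨m, v, f, hm, hv0, hvm, h'⟩ := htw
  refine ⟨l + m, fun i => if i ≤ l then u i else v (i - l),
    fun i => if i < l then e i else f (i - l), by omega, by simpa using hu0, ?_, fun i hi => ?_⟩
  · simpa [show ¬ l + m ≤ l by omega] using hvm
  · rcases lt_trichotomy i l with hil | rfl | hil
    · simpa [hil, hil.le, Nat.succ_le_of_lt hil] using h i hil
    · have := h' 0 (by omega)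
      rw [hv0, ← hul] at this
      simpa using this
    · have := h' (i - l) (by omega)
      rw [show i - l + 1 = i + 1 - l by omega] at this
      simpa [show ¬ i < l by omega, show ¬ i ≤ l by omega, show ¬ i + 1 ≤ l by omega] using this

section Layer

variable {V : Type*} [Fintype V] [DecidableEq V] {E : Finset (Finset V)}
  {Hd : Finset V → Finset V} {k : ℕ} {x y : V}

theorem mem_denseSet : x ∈ denseSet E Hd k ↔
    k ≤ indeg E Hd x ∨ ∃ s, k ≤ indeg E Hd s ∧ Reaches E Hd x s := by
  simp [denseSet]

theorem mem_denseSet_of_reaches (hxy : Reaches E Hd x y) (hy : y ∈ denseSet E Hd k) :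
    x ∈ denseSet E Hd k := by
  rw [mem_denseSet] at hy ⊢
  rcases hy with hy | ⟨s, hs, hys⟩
  · exact Or.inr ⟨y, hy, hxy⟩
  · exact Or.inr ⟨s, hs, hxy.append hys⟩

theorem indeg_le_of_notMem_denseSet (hx : x ∉ denseSet E Hd (k + 1)) : indeg E Hd x ≤ k := by
  by_contra! h
  exact hx (mem_denseSet.2 (Or.inl h))

theorem Egalitarian.le_indeg_add_one {δ : ℕ} (hega : Egalitarian E δ Hd)
    (hx : x ∈ denseSet E Hd k) : k ≤ indeg E Hd x + 1 := by
  rcases mem_denseSet.1 hx with h | ⟨s, hs, hxs⟩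
  · omega
  · have := hega.2 x s hxs
    omega

/-- A nonempty layer contains a vertex of indegree at least `k`. -/
theorem exists_le_indeg_of_layer_nonempty
    (hL : (denseSet E Hd k \ denseSet E Hd (k + 1)).Nonempty) :
    ∃ s ∈ denseSet E Hd k \ denseSet E Hd (k + 1), k ≤ indeg E Hd s := by
  obtain ⟨x, hx⟩ := hL
  have hx' := mem_sdiff.1 hx
  rcases mem_denseSet.1 hx'.1 with h | ⟨s, hs, hxs⟩
  · exact ⟨x, hx, h⟩
  · exact ⟨s, mem_sdiff.2 ⟨mem_denseSet.2 (Or.inl hs),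
      fun h => hx'.2 (mem_denseSet_of_reaches hxs h)⟩, hs⟩

end Layer

/-- the layer `L = D_{k,δ} \ D_{k+1,δ}`, when nonempty, has density
`k - 1 < ρ_d(L) ≤ k`; in particular `⌈ρ_d(L)⌉ = k` when `k ≥ 1`. -/
theorem stmt11 {V : Type*} [Fintype V] [DecidableEq V]
    (E : Finset (Finset V)) (hE : ∀ e ∈ E, e.Nonempty)
    (δ : ℕ) (hδ : 1 ≤ δ)
    (Hd : Finset V → Finset V) (hega : Egalitarian E δ Hd) (k : ℕ)
    (hL : (denseSet E Hd k \ denseSet E Hd (k + 1)).Nonempty) :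
    (k : ℝ) - 1 < rhod E Hd (denseSet E Hd k \ denseSet E Hd (k + 1)) ∧
      rhod E Hd (denseSet E Hd k \ denseSet E Hd (k + 1)) ≤ (k : ℝ) ∧
      (1 ≤ k → ⌈rhod E Hd (denseSet E Hd k \ denseSet E Hd (k + 1))⌉ = (k : ℤ)) := by
  have hlt : (k : ℝ) - 1 < rhod E Hd (denseSet E Hd k \ denseSet E Hd (k + 1)) := by
    rw [rhod, lt_div_iff₀ (by exact_mod_cast hL.card_pos), mul_comm, ← nsmul_eq_mul,
      ← sum_const]
    obtain ⟨s, hs, hks⟩ := exists_le_indeg_of_layer_nonempty hL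
    refine sum_lt_sum (fun x hx => ?_) ⟨s, hs, ?_⟩
    · have : (k : ℝ) ≤ indeg E Hd x + 1 := by
        exact_mod_cast hega.le_indeg_add_one (mem_sdiff.1 hx).1
      linarith
    · have : (k : ℝ) ≤ indeg E Hd s := by exact_mod_cast hks
      linarith
  have hle : rhod E Hd (denseSet E Hd k \ denseSet E Hd (k + 1)) ≤ (k : ℝ) := by
    rw [rhod, div_le_iff₀ (by exact_mod_cast hL.card_pos), mul_comm, ← nsmul_eq_mul]
    refine sum_le_card_nsmul _ _ _ fun x hx => ?_
    exact_mod_cast indeg_le_of_notMem_denseSet (mem_sdiff.1 hx).2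
  exact ⟨hlt, hle, fun _ => Int.ceil_eq_iff.2 ⟨by exact_mod_cast hlt, by exact_mod_cast hle⟩⟩
end

section
/- Let H = (V, E) be a hypergraph with an egalitarian δ-orientation, let k be a non-negative integer, and suppose the (k,δ)-dense subhypergraph D_{k,δ} is nonempty and contains at least one hyperedge, i.e., E(D_{k,δ}) ≠ ∅. Then the edge–vertex ratio satisfies |E(D_{k,δ})|/|D_{k,δ}| ≥ θ(D_{k,δ})·((k − 1) + f_k)/r̄(D_{k,δ}), where r̄(D_{k,δ}) = (Σ_{e∈E(D_{k,δ})} |e|)/|E(D_{k,δ})| is the average size of the internal hyperedges, θ(D_{k,δ}) is the internalization coefficient, and f_k = |S_k|/|D_{k,δ}|. -/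
open Finset

lemma Sk_subset_denseSet {V : Type*} [Fintype V] [DecidableEq V]
    (E : Finset (Finset V)) (Hd : Finset V → Finset V) (k : ℕ) :
    Sk E Hd k ⊆ denseSet E Hd k := by
  intro u hu
  simp only [Sk, denseSet, Finset.mem_filter, Finset.mem_univ, true_and] at hu ⊢
  exact Or.inl hu

lemma Egalitarian.le_indeg_add_one_of_mem_denseSet {V : Type*} [Fintype V] [DecidableEq V]
    {E : Finset (Finset V)} {δ : ℕ} {Hd : Finset V → Finset V} (h : Egalitarian E δ Hd)
    {k : ℕ} {u : V} (hu : u ∈ denseSet E Hd k) : k ≤ indeg E Hd u + 1 := by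
  simp only [denseSet, Finset.mem_filter, Finset.mem_univ, true_and] at hu
  rcases hu with hu | ⟨s, hs, hus⟩
  · omega
  · have := h.2 u s hus
    omega

lemma Egalitarian.le_sum_indeg_denseSet {V : Type*} [Fintype V] [DecidableEq V]
    {E : Finset (Finset V)} {δ : ℕ} {Hd : Finset V → Finset V} (h : Egalitarian E δ Hd)
    (k : ℕ) :
    ((k : ℝ) - 1) * ((denseSet E Hd k).card : ℝ) + ((Sk E Hd k).card : ℝ) ≤
      ∑ x ∈ denseSet E Hd k, (indeg E Hd x : ℝ) := by
  have hcard : ((Sk E Hd k).card : ℝ) =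
      ∑ x ∈ denseSet E Hd k, if x ∈ Sk E Hd k then (1 : ℝ) else 0 := by
    rw [Finset.sum_ite_mem, Finset.inter_eq_right.2 (Sk_subset_denseSet E Hd k)]
    simp
  rw [hcard, mul_comm, ← nsmul_eq_mul, ← Finset.sum_const, ← Finset.sum_add_distrib]
  refine Finset.sum_le_sum fun x hx => ?_
  split_ifs with hxS
  · have hk : (k : ℝ) ≤ indeg E Hd x := by
      exact_mod_cast (Finset.mem_filter.1 hxS).2
    linarith
  · have hk : (k : ℝ) ≤ indeg E Hd x + 1 := by
      exact_mod_cast h.le_indeg_add_one_of_mem_denseSet hx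
    linarith

lemma Egalitarian.sub_one_add_fk_le_rhod {V : Type*} [Fintype V] [DecidableEq V]
    {E : Finset (Finset V)} {δ : ℕ} {Hd : Finset V → Finset V} (h : Egalitarian E δ Hd)
    {k : ℕ} (hD : (denseSet E Hd k).Nonempty) :
    ((k : ℝ) - 1) + fk E Hd k ≤ rhod E Hd (denseSet E Hd k) := by
  have hpos : (0 : ℝ) < (denseSet E Hd k).card := by exact_mod_cast hD.card_pos
  rw [fk, rhod, le_div_iff₀ hpos, add_mul, div_mul_cancel₀ _ hpos.ne']
  exact h.le_sum_indeg_denseSet k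

lemma theta_nonneg {V : Type*} [DecidableEq V] (E : Finset (Finset V))
    (Hd : Finset V → Finset V) (X : Finset V) : 0 ≤ theta E Hd X := by
  unfold theta
  positivity

lemma rbar_nonneg {V : Type*} [DecidableEq V] (E : Finset (Finset V)) (X : Finset V) :
    0 ≤ rbar E X := by
  unfold rbar
  positivity

lemma IsOrientation.theta_mul_rhod_le {V : Type*} [DecidableEq V]
    {E : Finset (Finset V)} {δ : ℕ} {Hd : Finset V → Finset V} (h : IsOrientation E δ Hd)
    (X : Finset V) :
    theta E Hd X * rhod E Hd X ≤ (∑ e ∈ edgesIn E X, (e.card : ℝ)) / (X.card : ℝ) := by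
  have hsum : ∑ e ∈ edgesIn E X, ((Hd e).card : ℝ) ≤ ∑ e ∈ edgesIn E X, (e.card : ℝ) :=
    Finset.sum_le_sum fun e he => by
      exact_mod_cast Finset.card_le_card (h e (Finset.mem_filter.1 he).1).1
  rw [theta, rhod, ← mul_div_assoc]
  gcongr
  rcases eq_or_ne (∑ x ∈ X, (indeg E Hd x : ℝ)) 0 with h0 | h0
  · rw [h0, mul_zero]
    positivity
  · rwa [div_mul_cancel₀ _ h0]

/-- if `D_{k,δ}` is nonempty and contains at least one hyperedge, then
`|E(D_{k,δ})|/|D_{k,δ}| ≥ θ(D_{k,δ})·((k - 1) + f_k)/r̄(D_{k,δ})`. -/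
theorem stmt17 {V : Type*} [Fintype V] [DecidableEq V]
    (E : Finset (Finset V)) (hE : ∀ e ∈ E, e.Nonempty)
    (δ : ℕ) (hδ : 1 ≤ δ)
    (Hd : Finset V → Finset V) (hega : Egalitarian E δ Hd) (k : ℕ)
    (hD : (denseSet E Hd k).Nonempty)
    (hED : (edgesIn E (denseSet E Hd k)).Nonempty) :
    theta E Hd (denseSet E Hd k) * (((k : ℝ) - 1) + fk E Hd k) /
        rbar E (denseSet E Hd k) ≤
      ((edgesIn E (denseSet E Hd k)).card : ℝ) / ((denseSet E Hd k).card : ℝ) := by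
  refine div_le_of_le_mul₀ (rbar_nonneg _ _) (by positivity) ?_
  have hm : ((edgesIn E (denseSet E Hd k)).card : ℝ) ≠ 0 := by
    exact_mod_cast hED.card_pos.ne'
  calc _ ≤ theta E Hd (denseSet E Hd k) * rhod E Hd (denseSet E Hd k) :=
        mul_le_mul_of_nonneg_left (hega.sub_one_add_fk_le_rhod hD) (theta_nonneg _ _ _)
    _ ≤ _ := hega.1.theta_mul_rhod_le _
    _ = _ := by
        rw [rbar]
        field_simp
end
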